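/- Let S ⊂ R^d be finite with minimum-spanning-tree longest edge R_min, and suppose r : S → R_{>0} gives a connected symmetric communication graph with interference i. Then there exists r̄ : S → R_{>0} with r̄(s) ≤ R_min for all s, whose symmetric communication graph is connected, and whose interference is at most C(d) · i for a constant C(d) depending only on the dimension d. -/

import Mathlib

open scoped Classical

/-- The Euclidean length of an unordered pair of points of `ℝ^d`. -/
noncomputable def edgeLen (d : ℕ) : Sym2 (EuclideanSpace ℝ (Fin d)) → ℝ :=
  Sym2.lift ⟨fun a b => dist a b, fun a b => dist_comm a b⟩

/-- The total Euclidean edge length of a graph on the points of a finite set `S`. -/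
noncomputable def graphWeight (d : ℕ) (S : Finset (EuclideanSpace ℝ (Fin d)))
    (T : SimpleGraph {x // x ∈ S}) : ℝ :=
  ∑ e ∈ T.edgeFinset, edgeLen d (e.map Subtype.val)

/-- Connectivity (reachability) in the symmetric communication graph of the radii
assignment `ρ` on `S`: edge `st` iff `min (ρ s) (ρ t) ≥ dist s t`. -/
def symReach {d : ℕ} (S : Finset (EuclideanSpace ℝ (Fin d)))
    (ρ : EuclideanSpace ℝ (Fin d) → ℝ) :
    EuclideanSpace ℝ (Fin d) → EuclideanSpace ℝ (Fin d) → Prop :=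
  Relation.ReflTransGen (fun u v => u ∈ S ∧ v ∈ S ∧ u ≠ v ∧ dist u v ≤ min (ρ u) (ρ v))

namespace BRI

/-- available radius -/
def Avail {E : Type*} (r : E → ℝ) (Z : Finset (E × ℝ)) (u : E) (t : ℝ) : Prop :=
  t ≤ r u ∨ ∃ t', (u, t') ∈ Z ∧ t ≤ t'

def Adj {E : Type*} [MetricSpace E] (S : Finset E) (r : E → ℝ) (Z : Finset (E × ℝ)) (u v : E) : Prop :=
  u ∈ S ∧ v ∈ S ∧ Avail r Z u (dist u v) ∧ Avail r Z v (dist u v)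

def Reach {E : Type*} [MetricSpace E] (S : Finset E) (r : E → ℝ) (Z : Finset (E × ℝ)) : E → E → Prop :=
  Relation.ReflTransGen (Adj S r Z)

noncomputable def cov {E : Type*} [MetricSpace E] (r : E → ℝ) (Z : Finset (E × ℝ)) (p : E) : ℕ :=
  (Z.filter fun z => r z.1 < z.2 ∧ dist z.1 p ≤ z.2).card

section basic
set_option linter.unusedSectionVars false
variable {E : Type*} [MetricSpace E] {S : Finset E} {r : E → ℝ} {Z Z' : Finset (E × ℝ)}

lemma Avail.mono (h : Z ⊆ Z') {u : E} {t : ℝ} (ha : Avail r Z u t) : Avail r Z' u t := by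
  rcases ha with h1 | ⟨t', h1, h2⟩
  · exact Or.inl h1
  · exact Or.inr ⟨t', h h1, h2⟩

lemma Adj.symm {u v : E} (h : Adj S r Z u v) : Adj S r Z v u := by
  obtain ⟨a, b, c, e⟩ := h
  rw [dist_comm] at c e
  exact ⟨b, a, e, c⟩

lemma Reach.mono (h : Z ⊆ Z') {u v : E} (ha : Reach S r Z u v) : Reach S r Z' u v := by
  induction ha with
  | refl => exact Relation.ReflTransGen.refl
  | tail _ h2 ih =>
    obtain ⟨h1, h2, h3, h4⟩ := h2
    exact Relation.ReflTransGen.tail ih ⟨h1, h2, h3.mono h, h4.mono h⟩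

lemma Reach.symm {u v : E} (h : Reach S r Z u v) : Reach S r Z v u := by
  induction h with
  | refl => exact Relation.ReflTransGen.refl
  | tail _ h2 ih => exact Relation.ReflTransGen.head h2.symm ih

lemma Reach.trans {u v w : E} (h : Reach S r Z u v) (h' : Reach S r Z v w) : Reach S r Z u w :=
  Relation.ReflTransGen.trans h h'

lemma Adj.reach {u v : E} (h : Adj S r Z u v) : Reach S r Z u v := Relation.ReflTransGen.single h

lemma cov_union [DecidableEq (E × ℝ)] (p : E) : cov r (Z ∪ Z') p ≤ cov r Z p + cov r Z' p := by
  unfold cov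
  rw [Finset.filter_union]
  exact Finset.card_union_le _ _

lemma cov_le_card (p : E) : cov r Z p ≤ Z.card := Finset.card_filter_le _ _

lemma cov_empty (p : E) : cov r ∅ p = 0 := by simp [cov]

lemma cov_biUnion [DecidableEq (E × ℝ)] {ι : Type*} (I : Finset ι) (F : ι → Finset (E × ℝ)) (p : E) :
    cov r (I.biUnion F) p ≤ ∑ c ∈ I, cov r (F c) p := by
  unfold cov
  rw [Finset.filter_biUnion]
  exact Finset.card_biUnion_le

lemma exists_of_cov_ne (p : E) (h : cov r Z p ≠ 0) :
    ∃ z ∈ Z, r z.1 < z.2 ∧ dist z.1 p ≤ z.2 := by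
  obtain ⟨z, hz⟩ := Finset.card_ne_zero.1 h
  rw [Finset.mem_filter] at hz
  exact ⟨z, hz.1, hz.2⟩

/-- choose representatives -/
lemma exists_reps {α β : Type*} [DecidableEq β] (X : Finset α) (f : α → β) :
    ∃ Y ⊆ X, Set.InjOn f Y ∧ Y.image f = X.image f := by
  obtain ⟨Y, h1, h2, h3⟩ := Finset.exists_subset_injOn_image_eq_of_surjOn (f := f) X (X.image f)
    (by intro y hy; simpa using hy)
  exact ⟨Y, h1, h2, h3⟩

lemma image_submod {α β γ : Type*} (f : α → β) (g : α → γ)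
    (hfg : ∀ a b, f a = f b → g a = g b) (X' X : Finset α) (h : X' ⊆ X) :
    (X'.image f).card + (X.image g).card ≤ (X.image f).card + (X'.image g).card := by
  have key : ∀ T : Finset α, (X'.image f).card + ((X' ∪ T).image g).card
      ≤ ((X' ∪ T).image f).card + (X'.image g).card := by
    intro T
    induction T using Finset.induction with
    | empty => simp
    | insert a T ha ih =>
      rw [Finset.union_insert, Finset.image_insert, Finset.image_insert,
        Finset.card_insert_eq_ite, Finset.card_insert_eq_ite]
      have : f a ∈ (X' ∪ T).image f → g a ∈ (X' ∪ T).image g := by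
        intro h
        obtain ⟨b, hb, e⟩ := Finset.mem_image.1 h
        exact Finset.mem_image.2 ⟨b, hb, hfg _ _ e⟩
      split_ifs <;> first | omega | (exfalso; tauto)
  have := key X
  rwa [Finset.union_eq_right.2 h] at this

end basic
end BRI

namespace BRI

structure Setup (E τ : Type) [MetricSpace E] where
  S : Finset E
  r : E → ℝ
  x : E
  X0 : Finset E
  u : E → ℝ → E
  κ : ℕ → E → τ
  lam : ℕ → ℝ
  J : ℕ
  C1 : ℕ
  M : ℕ
  A : ℕ
  hlo : ℝ
  hhi : ℝ
  hle : hlo ≤ hhi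
  lam_pos : ∀ s, 0 < lam s
  lam_succ : ∀ s, lam (s+1) = lam s / 4
  uS : ∀ q ∈ X0, ∀ h, hlo ≤ h → h ≤ hhi → u q h ∈ S
  ureach : ∀ q ∈ X0, ∀ h, hlo ≤ h → h ≤ hhi → Reach S r ∅ q (u q h)
  ud1 : ∀ q ∈ X0, ∀ h, hlo ≤ h → h ≤ hhi → dist (u q h) x ≤ h
  ud2 : ∀ q ∈ X0, ∀ h, hlo ≤ h → h ≤ hhi → h ≤ dist (u q h) x + r (u q h)
  k1 : ∀ s a b, κ s a = κ s b → dist a b ≤ lam s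
  k2 : ∀ s a b, κ (s+1) a = κ (s+1) b → κ s a = κ s b
  k3 : ∀ s p (Y : Finset E), Set.InjOn (κ (s+1)) Y → (∀ y ∈ Y, dist y p ≤ lam s) → Y.card ≤ C1
  k4 : ∀ s (Y : Finset E), (∀ y ∈ Y, dist y x ≤ hhi) → (Y.image (κ s)).card ≤ M * A ^ s
  kJ : ∀ h, hlo ≤ h → h ≤ hhi → Set.InjOn (fun q => κ J (u q h)) X0

namespace Setup
variable {E τ : Type} [MetricSpace E] (P : Setup E τ)

noncomputable def m (s : ℕ) (X : Finset E) (h : ℝ) : ℕ := (X.image (fun q => P.κ s (P.u q h))).card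

structure Res (Z : Finset (E × ℝ)) (X X' : Finset E) (α β l : ℝ) : Prop where
  sub : X' ⊆ X
  link : ∀ q ∈ X, ∃ q' ∈ X', Reach P.S P.r Z q q'
  covle : ∀ p, cov P.r Z p ≤ P.C1
  supp : ∀ p, cov P.r Z p ≠ 0 → α < dist p P.x ∧ dist p P.x < β
  rad : ∀ z ∈ Z, z.2 ≤ l

lemma Res.refl (X : Finset E) (α β l : ℝ) : P.Res ∅ X X α β l where
  sub := subset_rfl
  link q hq := ⟨q, hq, Relation.ReflTransGen.refl⟩
  covle p := by simp [cov_empty]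
  supp p hp := by simp [cov_empty] at hp
  rad := by simp

variable {P}

lemma Res.weaken {Z X X' α β l} (h : P.Res Z X X' α β l) {α' β' l' : ℝ} (h1 : α' ≤ α) (h2 : β ≤ β')
    (h3 : l ≤ l') : P.Res Z X X' α' β' l' where
  sub := h.sub
  link := h.link
  covle := h.covle
  supp p hp := ⟨h1.trans_lt (h.supp p hp).1, (h.supp p hp).2.trans_le h2⟩
  rad z hz := (h.rad z hz).trans h3

lemma Res.comp {Z X X' α β l} (h : P.Res Z X X' α β l) {Z₂ X'' α₂ β₂}
    (h' : P.Res Z₂ X' X'' α₂ β₂ l) (hd : β ≤ α₂ ∨ β₂ ≤ α) {a b : ℝ} (ha : a ≤ α) (ha2 : a ≤ α₂)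
    (hb : β ≤ b) (hb2 : β₂ ≤ b) : P.Res (Z ∪ Z₂) X X'' a b l where
  sub := h'.sub.trans h.sub
  link q hq := by
    obtain ⟨q1, h1, h2⟩ := h.link q hq
    obtain ⟨q2, h3, h4⟩ := h'.link q1 h1
    exact ⟨q2, h3, (h2.mono Finset.subset_union_left).trans (h4.mono Finset.subset_union_right)⟩
  covle p := by
    have := cov_union (r := P.r) (Z := Z) (Z' := Z₂) p
    have h1 := h.covle p
    have h2 := h'.covle p
    by_cases e1 : cov P.r Z p = 0
    · omega
    by_cases e2 : cov P.r Z₂ p = 0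
    · omega
    have a1 := h.supp p e1
    have a2 := h'.supp p e2
    exfalso
    rcases hd with hd | hd <;> linarith
  supp p hp := by
    have := cov_union (r := P.r) (Z := Z) (Z' := Z₂) p
    by_cases e1 : cov P.r Z p = 0
    · have e2 : cov P.r Z₂ p ≠ 0 := by omega
      have a2 := h'.supp p e2
      constructor <;> linarith
    · have a2 := h.supp p e1
      constructor <;> linarith
  rad z hz := by
    rcases Finset.mem_union.1 hz with hz | hz
    · exact h.rad z hz
    · exact h'.rad z hz

variable (P)

lemma m_mono {s : ℕ} {X X' : Finset E} (h : X' ⊆ X) (t : ℝ) : P.m s X' t ≤ P.m s X t :=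
  Finset.card_le_card (Finset.image_subset_image h)

lemma m_submod {s : ℕ} {X X' : Finset E} (h : X' ⊆ X) (t : ℝ) :
    P.m (s+1) X' t + P.m s X t ≤ P.m (s+1) X t + P.m s X' t :=
  image_submod _ _ (fun _ _ hab => P.k2 s _ _ hab) X' X h

lemma m_le_card (s : ℕ) (X : Finset E) (t : ℝ) : P.m s X t ≤ X.card := Finset.card_image_le

lemma m_J {X : Finset E} (hX : X ⊆ P.X0) {h : ℝ} (h1 : P.hlo ≤ h) (h2 : h ≤ P.hhi) :
    P.m P.J X h = X.card :=
  Finset.card_image_of_injOn ((P.kJ h h1 h2).mono (by exact_mod_cast hX))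

lemma m_le {X : Finset E} (hX : X ⊆ P.X0) {h : ℝ} (h1 : P.hlo ≤ h) (h2 : h ≤ P.hhi) (s : ℕ) :
    P.m s X h ≤ P.M * P.A ^ s := by
  have := P.k4 s (X.image fun q => P.u q h) (by
    intro y hy
    obtain ⟨q, hq, rfl⟩ := Finset.mem_image.1 hy
    exact (P.ud1 q (hX hq) h h1 h2).trans h2)
  rw [Finset.image_image] at this
  exact this

lemma step {X : Finset E} (hX : X ⊆ P.X0) {h : ℝ} (h1 : P.hlo ≤ h) (h2 : h ≤ P.hhi) (s : ℕ) :
    ∃ Z X', P.Res Z X X' (h - 2 * P.lam s) (h + 2 * P.lam s) (P.lam s) ∧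
      X'.card + P.m (s+1) X h ≤ X.card + P.m s X h := by
  obtain ⟨Y, hYX, hYi, hYe⟩ := exists_reps X (fun q => P.κ (s+1) (P.u q h))
  obtain ⟨Y0, hY0, hY0i, hY0e⟩ := exists_reps Y (fun q => P.κ s (P.u q h))
  have hl := P.lam_pos s
  refine ⟨Y.image (fun q => (P.u q h, P.lam s)), X \ (Y \ Y0), ⟨Finset.sdiff_subset, ?_, ?_, ?_, ?_⟩, ?_⟩
  · intro q hq
    by_cases hq' : q ∈ X \ (Y \ Y0)
    · exact ⟨q, hq', Relation.ReflTransGen.refl⟩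
    have hqY : q ∈ Y := by
      by_contra hh
      exact hq' (by simp [hq, hh])
    have : P.κ s (P.u q h) ∈ Y0.image (fun q => P.κ s (P.u q h)) := by
      rw [hY0e]; exact Finset.mem_image_of_mem (fun q => P.κ s (P.u q h)) hqY
    obtain ⟨q0, hq0, he⟩ := Finset.mem_image.1 this
    have hq0Y := hY0 hq0
    refine ⟨q0, by simp [hYX hq0Y, hq0], ?_⟩
    have d1 := P.k1 s _ _ he
    have a1 := (P.ureach q (hX hq) h h1 h2).mono (Finset.empty_subset (Y.image (fun q => (P.u q h, P.lam s))))
    have a2 := (P.ureach q0 (hX (hYX hq0Y)) h h1 h2).mono (Finset.empty_subset (Y.image (fun q => (P.u q h, P.lam s))))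
    refine a1.trans (Reach.trans (Adj.reach ?_) a2.symm)
    rw [dist_comm] at d1
    refine ⟨P.uS q (hX hq) h h1 h2, P.uS q0 (hX (hYX hq0Y)) h h1 h2, Or.inr ⟨_, ?_, d1⟩, Or.inr ⟨_, ?_, d1⟩⟩
    · exact Finset.mem_image.2 ⟨q, hqY, rfl⟩
    · exact Finset.mem_image.2 ⟨q0, hq0Y, rfl⟩
  · intro p
    let Y' := Y.filter (fun q => dist (P.u q h) p ≤ P.lam s)
    have hc := P.k3 s p (Y'.image (fun q => P.u q h)) (by
        intro a ha b hb hab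
        rw [Finset.mem_coe] at ha hb
        obtain ⟨q, hq, rfl⟩ := Finset.mem_image.1 ha
        obtain ⟨q', hq', rfl⟩ := Finset.mem_image.1 hb
        have := hYi (Finset.mem_coe.2 (Finset.mem_filter.1 hq).1)
          (Finset.mem_coe.2 (Finset.mem_filter.1 hq').1) hab
        rw [this]) (by
        intro y hy
        obtain ⟨q, hq, rfl⟩ := Finset.mem_image.1 hy
        exact (Finset.mem_filter.1 hq).2)
    refine le_trans ?_ hc
    unfold cov
    have : ((Y.image (fun q => (P.u q h, P.lam s))).filter
        fun z => P.r z.1 < z.2 ∧ dist z.1 p ≤ z.2) ⊆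
        (Y'.image (fun q => P.u q h)).image (fun y => (y, P.lam s)) := by
      intro z hz
      obtain ⟨hz1, hz2, hz3⟩ := Finset.mem_filter.1 hz
      obtain ⟨q, hq, rfl⟩ := Finset.mem_image.1 hz1
      exact Finset.mem_image.2 ⟨_, Finset.mem_image.2 ⟨q, Finset.mem_filter.2 ⟨hq, hz3⟩, rfl⟩, rfl⟩
    exact (Finset.card_le_card this).trans Finset.card_image_le
  · intro p hp
    obtain ⟨z, hz, hz2, hz3⟩ := exists_of_cov_ne p hp
    obtain ⟨q, hq, rfl⟩ := Finset.mem_image.1 hz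
    simp only at hz2 hz3
    have b1 := P.ud1 q (hX (hYX hq)) h h1 h2
    have b2 := P.ud2 q (hX (hYX hq)) h h1 h2
    have t1 := dist_triangle (P.u q h) p P.x
    have t2 := dist_triangle p (P.u q h) P.x
    rw [dist_comm p (P.u q h)] at t2
    constructor <;> linarith
  · intro z hz
    obtain ⟨q, hq, rfl⟩ := Finset.mem_image.1 hz
    exact le_rfl
  · have c1 : (Y \ Y0).card + Y0.card = Y.card := Finset.card_sdiff_add_card_eq_card hY0
    have c2 : (X \ (Y \ Y0)).card + (Y \ Y0).card = X.card :=
      Finset.card_sdiff_add_card_eq_card (Finset.sdiff_subset.trans hYX)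
    have c3 : Y.card = P.m (s+1) X h := by
      unfold m; rw [← hYe, Finset.card_image_of_injOn hYi]
    have c4 : Y0.card = P.m s Y h := by
      unfold m; rw [← hY0e, Finset.card_image_of_injOn hY0i]
    have c5 := P.m_mono (s := s) hYX h
    omega

lemma round (k : ℕ) : ∀ s, s + k = P.J → ∀ X ⊆ P.X0, ∀ α β, P.hlo ≤ α → β ≤ P.hhi →
    16 * P.lam s ≤ β - α → ∃ Z X' h, P.Res Z X X' α β (P.lam s) ∧ α ≤ h ∧ h ≤ β ∧
      X'.card + X'.card ≤ X.card + P.m s X' h := by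
  induction k with
  | zero =>
    intro s hs X hX α β hα hβ hl
    have := P.lam_pos s
    refine ⟨∅, X, α, Res.refl P X _ _ _, le_rfl, by linarith, ?_⟩
    have : s = P.J := by omega
    rw [this, P.m_J hX hα (by linarith)]
  | succ k ih =>
    intro s hs X hX α β hα hβ hl
    have lp := P.lam_pos s
    have lp' := P.lam_succ s
    -- maximise the gain
    obtain ⟨h, ⟨hh1, hh2⟩, hmax⟩ : ∃ h, (α + 2 * P.lam s ≤ h ∧ h ≤ β - 2 * P.lam s) ∧
        ∀ t, (α + 2 * P.lam s ≤ t ∧ t ≤ β - 2 * P.lam s) →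
          P.m (s+1) X t + P.m s X h ≤ P.m (s+1) X h + P.m s X t := by
      let T : Set ℝ := {t | α + 2 * P.lam s ≤ t ∧ t ≤ β - 2 * P.lam s}
      let V : Set ℤ := (fun t => (P.m (s+1) X t : ℤ) - P.m s X t) '' T
      have hVb : BddAbove V := by
        refine ⟨X.card, ?_⟩
        rintro _ ⟨t, _, rfl⟩
        have := P.m_le_card (s+1) X t
        simp only
        omega
      have hVn : V.Nonempty := ⟨_, α + 2 * P.lam s, ⟨le_rfl, by linarith⟩, rfl⟩
      obtain ⟨t, ht, hte⟩ := Int.csSup_mem hVn hVb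
      refine ⟨t, ht, fun t' ht' => ?_⟩
      have := le_csSup hVb ⟨t', ht', rfl⟩
      rw [← hte] at this
      simp only at this
      omega
    obtain ⟨Z1, X1, hR, hc⟩ := P.step hX (h := h) (by linarith) (by linarith) s
    have fin : ∀ a b, α + 2 * P.lam s ≤ a → b ≤ β - 2 * P.lam s → 4 * P.lam s ≤ b - a →
        (b ≤ h - 2 * P.lam s ∨ h + 2 * P.lam s ≤ a) → ∃ Z X' h, P.Res Z X X' α β (P.lam s) ∧ α ≤ h ∧ h ≤ β ∧
      X'.card + X'.card ≤ X.card + P.m s X' h := by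
      intro a b ha hb hab hd
      obtain ⟨Z2, X2, t, hR2, ht1, ht2, hc2⟩ := ih (s+1) (by omega) X1 (hR.sub.trans hX) a b
        (by linarith) (by linarith) (by linarith)
      refine ⟨Z1 ∪ Z2, X2, t, hR.comp (hR2.weaken le_rfl le_rfl (by linarith)) (by tauto) (by linarith) (by linarith) (by linarith) (by linarith), by linarith, by linarith, ?_⟩
      have e1 := hmax t ⟨by linarith, by linarith⟩
      have e2 := P.m_submod (s := s) (hR2.sub.trans hR.sub) t
      omega
    rcases le_total (α + β) (2 * h) with hcase | hcase
    · exact fin (α + 2 * P.lam s) (h - 2 * P.lam s) (by linarith) (by linarith) (by linarith) (Or.inl le_rfl)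
    · exact fin (h + 2 * P.lam s) (β - 2 * P.lam s) (by linarith) (by linarith) (by linarith) (Or.inr le_rfl)

lemma rounds (s : ℕ) (hs : s ≤ P.J) (k : ℕ) : ∀ X ⊆ P.X0, ∀ α β, P.hlo ≤ α → β ≤ P.hhi →
    16 * k * P.lam s ≤ β - α → ∃ Z X', P.Res Z X X' α β (P.lam s) ∧
      2 ^ k * X'.card ≤ X.card + (2 ^ k - 1) * (P.M * P.A ^ s) := by
  induction k with
  | zero =>
    intro X hX α β hα hβ hl
    exact ⟨∅, X, Res.refl P X _ _ _, by simp⟩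
  | succ k ih =>
    intro X hX α β hα hβ hl
    have lp := P.lam_pos s
    push_cast at hl
    have hk : (0:ℝ) ≤ k * P.lam s := by positivity
    obtain ⟨Z1, X1, h1, hc1⟩ := ih X hX α (α + 16 * k * P.lam s) hα (by nlinarith) (by linarith)
    obtain ⟨Z2, X2, h, h2, ht1, ht2, hc2⟩ := P.round (P.J - s) s (by omega) X1 (h1.sub.trans hX)
      (α + 16 * k * P.lam s) β (by nlinarith) hβ (by nlinarith)
    refine ⟨Z1 ∪ Z2, X2, h1.comp h2 (Or.inl le_rfl) le_rfl (by nlinarith) (by nlinarith) le_rfl, ?_⟩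
    have e := P.m_le (h2.sub.trans (h1.sub.trans hX)) (h := h) (by nlinarith) (by linarith) s
    generalize P.M * P.A ^ s = N at *
    obtain ⟨y, hy⟩ : ∃ y, 2 ^ k = y + 1 := ⟨2^k-1, by have := Nat.one_le_two_pow (n := k); omega⟩
    rw [pow_succ]
    rw [hy] at hc1 ⊢
    have : (y + 1) * 2 - 1 = 2 * y + 1 := by omega
    rw [this]
    simp only [Nat.add_sub_cancel] at hc1
    nlinarith

lemma stage (k : ℕ) (hA : 2 * P.A ≤ 2 ^ k) (j : ℕ) : ∀ s, s + j = P.J → ∀ X ⊆ P.X0, ∀ α β,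
    P.hlo ≤ α → β ≤ P.hhi →
    32 * k * P.lam s ≤ β - α → ∃ Z X', P.Res Z X X' α β (P.lam s) ∧
      X'.card ≤ 2 * (P.M * P.A ^ s) := by
  induction j with
  | zero =>
    intro s hs X hX α β hα hβ hl
    refine ⟨∅, X, Res.refl P X _ _ _, ?_⟩
    have : s = P.J := by omega
    have e := P.m_le hX (h := P.hlo) le_rfl P.hle s
    rw [this] at *
    rw [P.m_J hX le_rfl P.hle] at e
    omega
  | succ j ih =>
    intro s hs X hX α β hα hβ hl
    have lp := P.lam_pos s
    have lp' := P.lam_succ s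
    have hk : (0:ℝ) ≤ k * P.lam s := by positivity
    obtain ⟨Z1, X1, h1, hc1⟩ := ih (s+1) (by omega) X hX α (α + 16 * k * P.lam s) hα (by nlinarith)
      (by rw [lp']; nlinarith)
    obtain ⟨Z2, X2, h2, hc2⟩ := P.rounds s (by omega) k X1 (h1.sub.trans hX)
      (α + 16 * k * P.lam s) β (by nlinarith) hβ (by nlinarith)
    refine ⟨Z1 ∪ Z2, X2, (h1.weaken le_rfl le_rfl (by linarith)).comp h2 (Or.inl le_rfl) le_rfl (by nlinarith) (by nlinarith) le_rfl, ?_⟩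
    have e : 2 * (P.M * P.A ^ (s+1)) ≤ 2 ^ k * (P.M * P.A ^ s) := by
      calc 2 * (P.M * P.A ^ (s+1)) = (2 * P.A) * (P.M * P.A ^ s) := by ring
        _ ≤ _ := Nat.mul_le_mul_right _ hA
    generalize P.M * P.A ^ s = N at *
    obtain ⟨y, hy⟩ : ∃ y, 2 ^ k = y + 1 := ⟨2^k-1, by have := Nat.one_le_two_pow (n := k); omega⟩
    rw [hy] at hc2 e
    simp only [Nat.add_sub_cancel] at hc2
    have : (y+1) * X2.card ≤ (y+1) * (2 * N) := by nlinarith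
    exact Nat.le_of_mul_le_mul_left this (by omega)

end Setup
end BRI

namespace BRI

def Cell (d : ℕ) : Type := Fin d → ℤ

noncomputable def gcell {d : ℕ} (η : ℝ) (y : EuclideanSpace ℝ (Fin d)) : Cell d := fun i => ⌊y i / η⌋

lemma gcell_dist {d : ℕ} {η : ℝ} (hη : 0 < η) {a b : EuclideanSpace ℝ (Fin d)}
    (h : gcell η a = gcell η b) : dist a b ≤ (d + 1) * η := by
  have h1 : ∀ i, dist (a i) (b i) ^ 2 ≤ η ^ 2 := by
    intro i
    have := Int.abs_sub_lt_one_of_floor_eq_floor (congrFun h i)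
    rw [← sub_div, abs_div, abs_of_pos hη, div_lt_one hη] at this
    rw [Real.dist_eq]
    exact pow_le_pow_left₀ (abs_nonneg _) this.le 2
  rw [EuclideanSpace.dist_eq]
  apply Real.sqrt_le_iff.2
  refine ⟨by positivity, ?_⟩
  calc ∑ i, dist (a i) (b i) ^ 2 ≤ ∑ i : Fin d, η ^ 2 := Finset.sum_le_sum fun i _ => h1 i
    _ = d * η ^ 2 := by simp
    _ ≤ _ := by
      have : (0:ℝ) ≤ d := by positivity
      nlinarith [sq_nonneg η, mul_nonneg this (sq_nonneg η), mul_nonneg (mul_nonneg this this) (sq_nonneg η)]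

lemma gcell_nest {d : ℕ} {η : ℝ} {a b : EuclideanSpace ℝ (Fin d)}
    (h : gcell (η / 4) a = gcell (η / 4) b) : gcell η a = gcell η b := by
  funext i
  have h1 := congrFun h i
  simp only [gcell] at h1 ⊢
  have key : ∀ t : ℝ, ⌊t / η⌋ = ⌊t / (η / 4)⌋ / (4 : ℕ) := by
    intro t
    rw [← Int.floor_div_natCast]
    congr 1
    push_cast
    rw [div_div_eq_mul_div, div_div, mul_comm η 4, mul_comm t 4]
    rw [mul_div_mul_left _ _ (by norm_num)]
  rw [key, key, h1]

lemma gcell_card {d : ℕ} {η t : ℝ} (hη : 0 < η) (p : EuclideanSpace ℝ (Fin d)) (N : ℕ)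
    (hN : 2 * t / η + 2 ≤ N) (Y : Finset (EuclideanSpace ℝ (Fin d)))
    (hY : ∀ y ∈ Y, dist y p ≤ t) : (Y.image (gcell η)).card ≤ N ^ d := by
  let B : Finset (Fin d → ℤ) := Fintype.piFinset fun i =>
    Finset.Icc ⌊(p i - t) / η⌋ ⌊(p i + t) / η⌋
  have hsub : (Y.image (gcell η) : Finset (Cell d)) ⊆ (B : Finset (Cell d)) := by
    intro c hc
    obtain ⟨y, hy, rfl⟩ := Finset.mem_image.1 hc
    refine Fintype.mem_piFinset.2 fun i => ?_
    have h1 : |y i - p i| ≤ t := by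
      have h2 := hY y hy
      rw [EuclideanSpace.dist_eq] at h2
      refine le_trans ?_ h2
      apply Real.le_sqrt_of_sq_le
      rw [← Real.dist_eq]
      exact Finset.single_le_sum (f := fun i => dist (y i) (p i) ^ 2) (fun i _ => sq_nonneg _) (Finset.mem_univ i)
    rw [abs_le] at h1
    rw [Finset.mem_Icc]
    constructor <;> apply Int.floor_le_floor <;> apply div_le_div_of_nonneg_right _ hη.le <;> linarith
  refine (Finset.card_le_card hsub).trans ?_
  have : B.card = ∏ i, (Finset.Icc ⌊(p i - t) / η⌋ ⌊(p i + t) / η⌋).card := Fintype.card_piFinset _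
  refine this.le.trans ?_
  refine (Finset.prod_le_pow_card _ _ N ?_).trans (by simp)
  intro i _
  rw [Int.card_Icc]
  have a1 := Int.floor_le ((p i + t) / η)
  have a2 := Int.lt_floor_add_one ((p i - t) / η)
  have a3 : (p i + t) / η - (p i - t) / η = 2 * t / η := by ring
  have : ((⌊(p i + t) / η⌋ + 1 - ⌊(p i - t) / η⌋ : ℤ) : ℝ) ≤ (N : ℤ) := by
    push_cast; linarith
  have := Int.cast_le.1 this
  omega

lemma exists_exit {α : Type*} {Rel : α → α → Prop} {p : α → Prop} {a b : α}
    (h : Relation.ReflTransGen Rel a b) (ha : p a) (hb : ¬ p b) :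
    ∃ c e, Relation.ReflTransGen Rel a c ∧ Rel c e ∧ p c ∧ ¬ p e := by
  induction h with
  | refl => exact absurd ha hb
  | @tail c e h1 h2 ih =>
    by_cases hc : p c
    · exact ⟨c, e, h1, h2, hc, hb⟩
    · exact ih hc

/-- constants -/
def cW (d : ℕ) : ℕ := 32 * (2 * d + 1)
def cM (d : ℕ) : ℕ := (4 * cW d * (d + 1) + 2) ^ d
def c1 (d : ℕ) : ℕ := (8 * d + 10) ^ d
def c2 (d : ℕ) : ℕ := (4 * d + 6) ^ d

lemma local_merge {d : ℕ} (S : Finset (EuclideanSpace ℝ (Fin d))) (R : ℝ) (hR : 0 < R)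
    (r : EuclideanSpace ℝ (Fin d) → ℝ)
    (hB : ∀ v ∈ S, ∃ a ∈ S, Reach S r ∅ v a ∧ r a = R)
    (x : EuclideanSpace ℝ (Fin d)) (Q : Finset (EuclideanSpace ℝ (Fin d))) (hQS : Q ⊆ S)
    (hQx : ∀ q ∈ Q, dist q x ≤ R) (hQQ : ∀ q ∈ Q, ∀ q' ∈ Q, dist q q' ≤ R) :
    ∃ Z : Finset (EuclideanSpace ℝ (Fin d) × ℝ), (∀ q ∈ Q, ∀ q' ∈ Q, Reach S r Z q q') ∧
      (∀ p, cov r Z p ≤ c1 d + (2 * cM d + c2 d)) ∧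
      (∀ p, cov r Z p ≠ 0 → dist p x ≤ 2 * R) ∧ ∀ z ∈ Z, z.2 ≤ R := by
  -- representatives of the components meeting Q
  let comp : EuclideanSpace ℝ (Fin d) → Finset (EuclideanSpace ℝ (Fin d)) :=
    fun q => S.filter (fun v => Reach S r ∅ q v)
  have hcomp : ∀ q ∈ S, ∀ q' ∈ S, comp q = comp q' ↔ Reach S r ∅ q q' := by
    intro q hq q' hq'
    constructor
    · intro h
      have : q' ∈ comp q' := Finset.mem_filter.2 ⟨hq', Relation.ReflTransGen.refl⟩
      rw [← h] at this
      exact (Finset.mem_filter.1 this).2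
    · intro h
      apply Finset.filter_congr
      intro v _
      exact ⟨fun h' => h.symm.trans h', fun h' => h.trans h'⟩
  obtain ⟨V, hVQ, hVi, hVe⟩ := exists_reps Q comp
  have hVr : ∀ q ∈ Q, ∃ v ∈ V, Reach S r ∅ q v := by
    intro q hq
    have : comp q ∈ V.image comp := by rw [hVe]; exact Finset.mem_image_of_mem comp hq
    obtain ⟨v, hv, he⟩ := Finset.mem_image.1 this
    exact ⟨v, hv, (hcomp q (hQS hq) v (hQS (hVQ hv))).1 he.symm⟩
  have hVd : ∀ v ∈ V, ∀ v' ∈ V, Reach S r ∅ v v' → v = v' := by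
    intro v hv v' hv' h
    exact hVi (Finset.mem_coe.2 hv) (Finset.mem_coe.2 hv')
      ((hcomp v (hQS (hVQ hv)) v' (hQS (hVQ hv'))).2 h)
  let X0 := V.filter (fun v => ∃ w, Reach S r ∅ v w ∧ 2 * R < dist w x)
  let V1 := V.filter (fun v => ¬ ∃ w, Reach S r ∅ v w ∧ 2 * R < dist w x)
  -- non crossing representatives
  have hV1 : V1.card ≤ c2 d := by
    choose! g hg1 hg2 hg3 using hB
    have hV1S : ∀ v ∈ V1, v ∈ S := fun v hv => hQS (hVQ (Finset.mem_filter.1 hv).1)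
    have hd : (0:ℝ) < d + 1 := by positivity
    have hinj : Set.InjOn (fun v => gcell (R / (d + 1)) (g v)) V1 := by
      intro v hv v' hv' h
      rw [Finset.mem_coe] at hv hv'
      have hS := hV1S v hv
      have hS' := hV1S v' hv'
      have hdist := gcell_dist (by positivity) h
      rw [mul_div_cancel₀ _ hd.ne'] at hdist
      refine hVd v (Finset.mem_filter.1 hv).1 v' (Finset.mem_filter.1 hv').1 ?_
      refine (hg2 v hS).trans (Reach.trans (Adj.reach ?_) (hg2 v' hS').symm)
      exact ⟨hg1 v hS, hg1 v' hS', Or.inl (by rw [hg3 v hS]; exact hdist),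
        Or.inl (by rw [hg3 v' hS']; exact hdist)⟩
    rw [← Finset.card_image_of_injOn hinj]
    have := gcell_card (η := R / (d + 1)) (t := 2 * R) (by positivity) x (4 * d + 6) (by
      push_cast
      have : 2 * (2 * R) / (R / (d+1)) = 4 * (d + 1) := by field_simp; ring
      rw [this]; linarith) (V1.image g) (by
      intro y hy
      obtain ⟨v, hv, rfl⟩ := Finset.mem_image.1 hy
      by_contra hh
      exact (Finset.mem_filter.1 hv).2 ⟨g v, hg2 v (hV1S v hv), lt_of_not_ge hh⟩)
    rw [Finset.image_image] at this
    exact this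
  -- crossing points
  have hu : ∀ q ∈ X0, ∀ h, R ≤ h → h ≤ 2 * R → ∃ a, a ∈ S ∧ Reach S r ∅ q a ∧ dist a x ≤ h ∧
      h ≤ dist a x + r a := by
    intro q hq h h1 h2
    obtain ⟨hqV, w, hw1, hw2⟩ := Finset.mem_filter.1 hq
    obtain ⟨a, b, ha1, hab, ha2, hb2⟩ := exists_exit (p := fun y => dist y x ≤ h) hw1
      ((hQx q (hVQ hqV)).trans h1) (by linarith)
    refine ⟨a, hab.1, ha1, ha2, ?_⟩
    have : dist a b ≤ r a := by
      rcases hab.2.2.1 with h | ⟨t, h, _⟩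
      · exact h
      · simp at h
    have := dist_triangle b a x
    rw [dist_comm b a] at this
    linarith
  choose! u hu1 hu2 hu3 hu4 using hu
  have hd : (0:ℝ) < d + 1 := by positivity
  have hW : (0:ℝ) < cW d := by unfold cW; positivity
  let lam : ℕ → ℝ := fun s => R / cW d / 4 ^ s
  have hlam : ∀ s, 0 < lam s := fun s => by positivity
  have hlams : ∀ s, lam (s+1) = lam s / 4 := fun s => by
    simp only [lam, pow_succ]; rw [div_div _ (4^s) 4]
  -- finest scale
  obtain ⟨J, hJ⟩ : ∃ J, ∀ a ∈ S, ∀ b ∈ S, dist a b ≤ lam J → a = b := by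
    have key : ∀ T : Finset (EuclideanSpace ℝ (Fin d) × EuclideanSpace ℝ (Fin d)),
        ∃ J, ∀ z ∈ T, ∀ j ≥ J, dist z.1 z.2 ≤ lam j → z.1 = z.2 := by
      intro T
      induction T using Finset.induction with
      | empty => exact ⟨0, by simp⟩
      | insert z T _ ih =>
        obtain ⟨J, hJ⟩ := ih
        by_cases hz : z.1 = z.2
        · refine ⟨J, fun y hy => ?_⟩
          rcases Finset.mem_insert.1 hy with rfl | hy
          · intros; exact hz
          · exact hJ y hy
        · have hpos : 0 < dist z.1 z.2 := dist_pos.2 hz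
          have hlim : Filter.Tendsto lam Filter.atTop (nhds 0) := by
            have := (tendsto_pow_atTop_nhds_zero_of_lt_one (r := (1/4:ℝ)) (by norm_num) (by norm_num)).const_mul (R / cW d)
            rw [mul_zero] at this
            refine this.congr fun n => ?_
            simp only [lam]; rw [one_div, inv_pow, div_eq_mul_inv _ ((4:ℝ) ^ n)]
          obtain ⟨J', hJ'⟩ := Filter.eventually_atTop.1 (hlim.eventually (gt_mem_nhds hpos))
          refine ⟨max J J', fun y hy j hj => ?_⟩
          rcases Finset.mem_insert.1 hy with rfl | hy
          · intro h
            have := hJ' j ((le_max_right _ _).trans hj)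
            linarith
          · exact hJ y hy j ((le_max_left _ _).trans hj)
    obtain ⟨J, hJ⟩ := key (S ×ˢ S)
    exact ⟨J, fun a ha b hb h => hJ (a, b) (Finset.mem_product.2 ⟨ha, hb⟩) J le_rfl h⟩
  let κ : ℕ → EuclideanSpace ℝ (Fin d) → Cell d := fun s => gcell (lam s / (d + 1))
  have hκ1 : ∀ s a b, κ s a = κ s b → dist a b ≤ lam s := by
    intro s a b h
    have := gcell_dist (div_pos (hlam s) hd) h
    rwa [mul_div_cancel₀ _ hd.ne'] at this
  let P : Setup (EuclideanSpace ℝ (Fin d)) (Cell d) :=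
    { S := S, r := r, x := x, X0 := X0, u := u, κ := κ, lam := lam, J := J, C1 := c1 d, M := cM d,
      A := 4 ^ d, hlo := R, hhi := 2 * R, hle := by linarith
      lam_pos := hlam
      lam_succ := hlams
      uS := hu1
      ureach := hu2
      ud1 := hu3
      ud2 := hu4
      k1 := hκ1
      k2 := by
        intro s a b h
        refine gcell_nest (η := lam s / (d + 1)) ?_
        have e : lam s / (d + 1) / 4 = lam (s+1) / (d + 1) := by rw [hlams]; ring
        rw [e]; exact h
      k3 := by
        intro s p Y hYi hYd
        rw [← Finset.card_image_of_injOn hYi]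
        refine gcell_card (div_pos (hlam _) hd) p (8 * d + 10) ?_ Y hYd
        have h1 := hlam s
        have : 2 * lam s / (lam (s+1) / (d+1)) = 8 * (d + 1) := by rw [hlams]; field_simp; ring
        rw [this]; push_cast; linarith
      k4 := by
        intro s Y hYd
        have := gcell_card (div_pos (hlam s) hd) x ((4 * cW d * (d + 1) + 2) * 4 ^ s) ?_ Y hYd
        · refine this.trans (le_of_eq ?_)
          rw [mul_pow, cM, ← pow_mul, ← pow_mul, mul_comm s d]
        · have : 2 * (2 * R) / (lam s / (d+1)) = 4 * cW d * (d + 1) * 4 ^ s := by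
            simp only [lam]; field_simp; ring
          rw [this]; push_cast
          have : (1:ℝ) ≤ 4 ^ s := one_le_pow₀ (by norm_num)
          linarith
      kJ := by
        intro h h1 h2 q hq q' hq' e
        rw [Finset.mem_coe] at hq hq'
        have e1 := hJ _ (hu1 q hq h h1 h2) _ (hu1 q' hq' h h1 h2) (hκ1 J _ _ e)
        refine hVd q (Finset.mem_filter.1 hq).1 q' (Finset.mem_filter.1 hq').1 ?_
        have t1 := hu2 q hq h h1 h2
        have t2 := hu2 q' hq' h h1 h2
        rw [← e1] at t2
        exact t1.trans t2.symm }
  obtain ⟨Z, X', hRes, hcard⟩ := P.stage (2 * d + 1) (by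
      change 2 * 4 ^ d ≤ _
      rw [pow_succ, pow_mul]; norm_num; omega) J 0 (by change 0 + J = J; omega) X0 subset_rfl R (2 * R) le_rfl le_rfl (by
      change 32 * ((2 * d + 1 : ℕ) : ℝ) * (R / cW d / 4 ^ 0) ≤ _
      have : (cW d : ℝ) = 32 * ((2 * d + 1 : ℕ) : ℝ) := by simp [cW]
      rw [pow_zero, div_one, ← this, mul_div_cancel₀ _ hW.ne']; linarith)
  have hcard' : X'.card ≤ 2 * cM d := by
    refine hcard.trans (le_of_eq ?_)
    change 2 * (cM d * (4 ^ d) ^ 0) = _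
    simp
  let Z2 : Finset (EuclideanSpace ℝ (Fin d) × ℝ) := (X' ∪ V1).image (fun q => (q, R))
  have hX'Q : X' ∪ V1 ⊆ Q := by
    intro q hq
    rcases Finset.mem_union.1 hq with hq | hq
    · exact hVQ (Finset.mem_filter.1 (hRes.sub hq)).1
    · exact hVQ (Finset.mem_filter.1 hq).1
  have hZ2c : ∀ p, cov r Z2 p ≤ 2 * cM d + c2 d := by
    intro p
    refine (cov_le_card p).trans (Finset.card_image_le.trans ((Finset.card_union_le _ _).trans ?_))
    omega
  refine ⟨Z ∪ Z2, ?_, ?_, ?_, ?_⟩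
  · have h1 : ∀ q ∈ Q, ∃ q' ∈ X' ∪ V1, Reach S r (Z ∪ Z2) q q' := by
      intro q hq
      obtain ⟨v, hv, hqv⟩ := hVr q hq
      have hqv' := hqv.mono (Finset.empty_subset (Z ∪ Z2))
      by_cases hc : ∃ w, Reach S r ∅ v w ∧ 2 * R < dist w x
      · obtain ⟨q', hq', hr⟩ := hRes.link v (Finset.mem_filter.2 ⟨hv, hc⟩)
        exact ⟨q', Finset.mem_union_left _ hq', hqv'.trans (Reach.mono Finset.subset_union_left hr)⟩
      · exact ⟨v, Finset.mem_union_right _ (Finset.mem_filter.2 ⟨hv, hc⟩), hqv'⟩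
    intro q hq q' hq'
    obtain ⟨a, ha, hqa⟩ := h1 q hq
    obtain ⟨b, hb, hqb⟩ := h1 q' hq'
    refine hqa.trans (Reach.trans (Adj.reach ?_) hqb.symm)
    have hm : ∀ c ∈ X' ∪ V1, (c, R) ∈ Z ∪ Z2 := fun c hc =>
      Finset.mem_union_right _ (Finset.mem_image.2 ⟨c, hc, rfl⟩)
    have hab := hQQ a (hX'Q ha) b (hX'Q hb)
    exact ⟨hQS (hX'Q ha), hQS (hX'Q hb), Or.inr ⟨R, hm a ha, hab⟩, Or.inr ⟨R, hm b hb, hab⟩⟩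
  · intro p
    exact (cov_union p).trans (add_le_add (hRes.covle p) (hZ2c p))
  · intro p hp
    by_cases h1 : cov r Z p = 0
    · have h2 : cov r Z2 p ≠ 0 := by
        have := cov_union (r := r) (Z := Z) (Z' := Z2) p
        omega
      obtain ⟨z, hz, hz1, hz2⟩ := exists_of_cov_ne p h2
      obtain ⟨q, hq, rfl⟩ := Finset.mem_image.1 hz
      have := hQx q (hX'Q hq)
      have t := dist_triangle p q x
      rw [dist_comm p q] at t
      simp only at hz2
      linarith
    · exact (hRes.supp p h1).2.le
  · intro z hz
    rcases Finset.mem_union.1 hz with hz | hz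
    · refine (hRes.rad z hz).trans ?_
      change R / cW d / 4 ^ 0 ≤ R
      rw [pow_zero, div_one]
      apply div_le_self hR.le
      have : 1 ≤ cW d := by unfold cW; omega
      exact_mod_cast this
    · obtain ⟨q, hq, rfl⟩ := Finset.mem_image.1 hz
      exact le_rfl
end BRI

namespace BRI

lemma exists_rbar {E : Type*} [MetricSpace E] (r : E → ℝ) (Z : Finset (E × ℝ)) :
    ∃ rb : E → ℝ, ∀ u t, t ≤ rb u ↔ Avail r Z u t := by
  induction Z using Finset.induction with
  | empty => exact ⟨r, fun u t => by simp [Avail]⟩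
  | insert z Z _ ih =>
    obtain ⟨rb, hrb⟩ := ih
    refine ⟨fun u => if u = z.1 then max (rb u) z.2 else rb u, fun u t => ?_⟩
    simp only
    split_ifs with h
    · subst h
      rw [le_max_iff, hrb]
      constructor
      · rintro (h | h)
        · exact h.mono (Finset.subset_insert _ _)
        · exact Or.inr ⟨z.2, Finset.mem_insert_self _ _, h⟩
      · rintro (h | ⟨t', h1, h2⟩)
        · exact Or.inl (Or.inl h)
        · rcases Finset.mem_insert.1 h1 with h1 | h1
          · right; rw [← h1]; exact h2
          · exact Or.inl (Or.inr ⟨t', h1, h2⟩)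
    · rw [hrb]
      constructor
      · intro h; exact h.mono (Finset.subset_insert _ _)
      · rintro (h' | ⟨t', h1, h2⟩)
        · exact Or.inl h'
        · rcases Finset.mem_insert.1 h1 with h1 | h1
          · exact absurd (by rw [← h1]) h
          · exact Or.inr ⟨t', h1, h2⟩

def c3 (d : ℕ) : ℕ := c1 d + (2 * cM d + c2 d) + 2 * c2 d
def c4 (d : ℕ) : ℕ := (6 * d + 8) ^ d

/-- one cell: merge everything in it, and add the witnesses towards neighbouring cells -/
lemma local_cell {d : ℕ} (S : Finset (EuclideanSpace ℝ (Fin d))) (R : ℝ) (hR : 0 < R)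
    (r : EuclideanSpace ℝ (Fin d) → ℝ)
    (hB : ∀ v ∈ S, ∃ a ∈ S, Reach S r ∅ v a ∧ r a = R)
    (x : EuclideanSpace ℝ (Fin d)) :
    ∃ Z : Finset (EuclideanSpace ℝ (Fin d) × ℝ),
      (∀ q ∈ S, ∀ q' ∈ S, gcell (R / (d+1)) q = gcell (R / (d+1)) x →
        gcell (R / (d+1)) q' = gcell (R / (d+1)) x → Reach S r Z q q') ∧
      (∀ a ∈ S, ∀ b ∈ S, gcell (R / (d+1)) a = gcell (R / (d+1)) x → dist a b ≤ R →
        ∃ a' ∈ S, ∃ b' ∈ S, gcell (R / (d+1)) a' = gcell (R / (d+1)) x ∧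
          gcell (R / (d+1)) b' = gcell (R / (d+1)) b ∧ Reach S r Z a' b') ∧
      (∀ p, cov r Z p ≤ c3 d) ∧
      (∀ p, cov r Z p ≠ 0 → dist p x ≤ 3 * R) ∧ ∀ z ∈ Z, z.2 ≤ R := by
  have hd : (0:ℝ) < d + 1 := by positivity
  have hη : 0 < R / (d + 1) := by positivity
  have hcd : ∀ a b : EuclideanSpace ℝ (Fin d), gcell (R / (d+1)) a = gcell (R / (d+1)) b → dist a b ≤ R := by
    intro a b h
    have := gcell_dist hη h
    rwa [mul_div_cancel₀ _ hd.ne'] at this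
  obtain ⟨Z, hZ1, hZ2, hZ3, hZ4⟩ := local_merge S R hR r hB x
    (S.filter fun q => gcell (R / (d+1)) q = gcell (R / (d+1)) x) (Finset.filter_subset _ _)
    (fun q hq => hcd _ _ (Finset.mem_filter.1 hq).2)
    (fun q hq q' hq' => hcd _ _ ((Finset.mem_filter.1 hq).2.trans (Finset.mem_filter.1 hq').2.symm))
  let B := S.filter fun b => ∃ a, a ∈ S ∧ gcell (R / (d+1)) a = gcell (R / (d+1)) x ∧ dist a b ≤ R
  obtain ⟨V, hVB, hVi, hVe⟩ := exists_reps B (gcell (R / (d+1)))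
  have hw : ∀ b ∈ V, ∃ a, a ∈ S ∧ gcell (R / (d+1)) a = gcell (R / (d+1)) x ∧ dist a b ≤ R :=
    fun b hb => (Finset.mem_filter.1 (hVB hb)).2
  have hVS : ∀ b ∈ V, b ∈ S := fun b hb => (Finset.mem_filter.1 (hVB hb)).1
  choose! w hw1 hw2 hw3 using hw
  have hVd : ∀ b ∈ V, dist b x ≤ 2 * R := by
    intro b hb
    have t1 := hw3 b hb
    have t2 := hcd _ _ (hw2 b hb)
    have t := dist_triangle b (w b) x
    rw [dist_comm b (w b)] at t
    linarith
  have hVc : V.card ≤ c2 d := by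
    rw [← Finset.card_image_of_injOn hVi]
    refine gcell_card (t := 2 * R) hη x (4 * d + 6) ?_ V hVd
    push_cast
    have : 2 * (2 * R) / (R / (d+1)) = 4 * (d + 1) := by field_simp; ring
    rw [this]; linarith
  let Z2 : Finset (EuclideanSpace ℝ (Fin d) × ℝ) :=
    V.image (fun b => (b, R)) ∪ V.image (fun b => (w b, R))
  have hZ2m : ∀ z ∈ Z2, z.2 = R ∧ dist z.1 x ≤ 2 * R := by
    intro z hz
    rcases Finset.mem_union.1 hz with hz | hz
    · obtain ⟨b, hb, rfl⟩ := Finset.mem_image.1 hz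
      exact ⟨rfl, hVd b hb⟩
    · obtain ⟨b, hb, rfl⟩ := Finset.mem_image.1 hz
      have t2 := hcd _ _ (hw2 b hb)
      refine ⟨rfl, ?_⟩
      simp only
      linarith
  have hZ2c : Z2.card ≤ 2 * c2 d := by
    refine (Finset.card_union_le _ _).trans ?_
    have a1 : (V.image (fun b => (b, R))).card ≤ V.card := Finset.card_image_le
    have a2 : (V.image (fun b => (w b, R))).card ≤ V.card := Finset.card_image_le
    omega
  refine ⟨Z ∪ Z2, ?_, ?_, ?_, ?_, ?_⟩
  · intro q hq q' hq' h h'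
    exact (hZ1 q (Finset.mem_filter.2 ⟨hq, h⟩) q' (Finset.mem_filter.2 ⟨hq', h'⟩)).mono
      Finset.subset_union_left
  · intro a ha b hb hax hab
    have hbB : gcell (R / (d+1)) b ∈ V.image (gcell (R / (d+1))) := by
      rw [hVe]
      exact Finset.mem_image_of_mem _ (Finset.mem_filter.2 ⟨hb, a, ha, hax, hab⟩)
    obtain ⟨b', hb', he⟩ := Finset.mem_image.1 hbB
    refine ⟨w b', hw1 b' hb', b', hVS b' hb', hw2 b' hb', he, Adj.reach ⟨hw1 b' hb', hVS b' hb', ?_, ?_⟩⟩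
    · exact Or.inr ⟨R, Finset.mem_union_right _ (Finset.mem_union_right _ (Finset.mem_image.2 ⟨b', hb', rfl⟩)), hw3 b' hb'⟩
    · exact Or.inr ⟨R, Finset.mem_union_right _ (Finset.mem_union_left _ (Finset.mem_image.2 ⟨b', hb', rfl⟩)), hw3 b' hb'⟩
  · intro p
    exact (cov_union p).trans (add_le_add (hZ2 p) ((cov_le_card p).trans hZ2c))
  · intro p hp
    by_cases h1 : cov r Z p = 0
    · have h2 : cov r Z2 p ≠ 0 := by
        have := cov_union (r := r) (Z := Z) (Z' := Z2) p
        omega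
      obtain ⟨z, hz, hz1, hz2⟩ := exists_of_cov_ne p h2
      obtain ⟨e1, e2⟩ := hZ2m z hz
      have t := dist_triangle p z.1 x
      rw [dist_comm p z.1] at t
      linarith
    · have := hZ3 p h1
      linarith
  · intro z hz
    rcases Finset.mem_union.1 hz with hz | hz
    · exact hZ4 z hz
    · exact (hZ2m z hz).1.le

lemma global_merge {d : ℕ} (S : Finset (EuclideanSpace ℝ (Fin d))) (R : ℝ) (hR : 0 < R)
    (r : EuclideanSpace ℝ (Fin d) → ℝ)
    (hB : ∀ v ∈ S, ∃ a ∈ S, Reach S r ∅ v a ∧ r a = R)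
    (hU : ∀ u ∈ S, ∀ v ∈ S, Relation.ReflTransGen (fun a b => a ∈ S ∧ b ∈ S ∧ dist a b ≤ R) u v) :
    ∃ Z : Finset (EuclideanSpace ℝ (Fin d) × ℝ),
      (∀ u ∈ S, ∀ v ∈ S, Reach S r Z u v) ∧
      (∀ p, cov r Z p ≤ c4 d * c3 d) ∧ ∀ z ∈ Z, z.2 ≤ R := by
  have hd : (0:ℝ) < d + 1 := by positivity
  have hη : 0 < R / (d + 1) := by positivity
  choose F hF1 hF2 hF3 hF4 hF5 using local_cell S R hR r hB
  obtain ⟨V, hVS, hVi, hVe⟩ := exists_reps S (gcell (R / (d+1)))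
  have hV : ∀ a ∈ S, ∃ x ∈ V, gcell (R / (d+1)) a = gcell (R / (d+1)) x := by
    intro a ha
    have : gcell (R / (d+1)) a ∈ V.image (gcell (R / (d+1))) := by
      rw [hVe]; exact Finset.mem_image_of_mem _ ha
    obtain ⟨x, hx, he⟩ := Finset.mem_image.1 this
    exact ⟨x, hx, he.symm⟩
  have hsame : ∀ a ∈ S, ∀ b ∈ S, gcell (R / (d+1)) a = gcell (R / (d+1)) b →
      Reach S r (V.biUnion F) a b := by
    intro a ha b hb hab
    obtain ⟨x, hx, he⟩ := hV a ha
    exact (hF1 x a ha b hb he (hab.symm.trans he)).mono (Finset.subset_biUnion_of_mem F hx)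
  refine ⟨V.biUnion F, ?_, ?_, ?_⟩
  · intro u hu v hv
    have := hU u hu v hv
    clear hv
    induction this with
    | refl => exact Relation.ReflTransGen.refl
    | @tail a b _ hab ih =>
      obtain ⟨ha, hb, hd⟩ := hab
      refine Reach.trans ih ?_
      obtain ⟨x, hx, he⟩ := hV a ha
      obtain ⟨a', ha', b', hb', e1, e2, h3⟩ := hF2 x a ha b hb he hd
      exact (hsame a ha a' ha' (he.trans e1.symm)).trans
        ((h3.mono (Finset.subset_biUnion_of_mem F hx)).trans (hsame b' hb' b hb e2))
  · intro p
    refine (cov_biUnion V F p).trans ?_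
    let V' := V.filter fun x => dist x p ≤ 3 * R
    have h1 : ∑ x ∈ V, cov r (F x) p = ∑ x ∈ V', cov r (F x) p := by
      symm
      apply Finset.sum_subset (Finset.filter_subset _ _)
      intro x hx hx'
      by_contra h
      have := hF4 x p h
      rw [dist_comm] at this
      exact hx' (Finset.mem_filter.2 ⟨hx, this⟩)
    rw [h1]
    refine (Finset.sum_le_card_nsmul _ _ (c3 d) fun x _ => hF3 x p).trans ?_
    rw [smul_eq_mul]
    apply Nat.mul_le_mul_right
    rw [← Finset.card_image_of_injOn (hVi.mono (Finset.coe_subset.2 (Finset.filter_subset _ V)))]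
    refine gcell_card (t := 3 * R) hη p (6 * d + 8) ?_ V' (fun y hy => (Finset.mem_filter.1 hy).2)
    push_cast
    have : 2 * (3 * R) / (R / (d+1)) = 6 * (d + 1) := by field_simp; ring
    rw [this]; linarith
  · intro z hz
    obtain ⟨x, _, hz⟩ := Finset.mem_biUnion.1 hz
    exact hF5 x z hz

lemma main {d : ℕ} (S : Finset (EuclideanSpace ℝ (Fin d))) (R : ℝ) (hR : 0 < R)
    (hS : S.Nonempty)
    (hU : ∀ u ∈ S, ∀ v ∈ S, Relation.ReflTransGen (fun a b => a ∈ S ∧ b ∈ S ∧ dist a b ≤ R) u v)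
    (r : EuclideanSpace ℝ (Fin d) → ℝ) (i : ℕ) (hpos : ∀ s ∈ S, 0 < r s)
    (hconn : ∀ u ∈ S, ∀ v ∈ S, symReach S r u v)
    (hi : ∀ p : EuclideanSpace ℝ (Fin d), (S.filter fun s => dist s p ≤ r s).card ≤ i) :
    ∃ rbar : EuclideanSpace ℝ (Fin d) → ℝ,
        (∀ s ∈ S, 0 < rbar s ∧ rbar s ≤ R) ∧
        (∀ u ∈ S, ∀ v ∈ S, symReach S rbar u v) ∧
        ∀ p : EuclideanSpace ℝ (Fin d),
          (S.filter fun s => dist s p ≤ rbar s).card ≤ (1 + c4 d * c3 d) * i := by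
  let r' : EuclideanSpace ℝ (Fin d) → ℝ := fun s => min (r s) R
  have hi1 : 1 ≤ i := by
    obtain ⟨s, hs⟩ := hS
    refine le_trans ?_ (hi s)
    apply Finset.card_pos.2
    exact ⟨s, Finset.mem_filter.2 ⟨hs, by rw [dist_self]; exact (hpos s hs).le⟩⟩
  obtain ⟨Z, hZ1, hZ2, hZ3⟩ : ∃ Z : Finset (EuclideanSpace ℝ (Fin d) × ℝ),
      (∀ u ∈ S, ∀ v ∈ S, Reach S r' Z u v) ∧
      (∀ p, cov r' Z p ≤ c4 d * c3 d) ∧ ∀ z ∈ Z, z.2 ≤ R := by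
    by_cases hc : ∀ u ∈ S, ∀ v ∈ S, Reach S r' ∅ u v
    · exact ⟨∅, hc, fun p => by simp [cov_empty], by simp⟩
    push Not at hc
    obtain ⟨u0, hu0, v0, hv0, hn⟩ := hc
    refine global_merge S R hR r' ?_ hU
    intro v hv
    obtain ⟨w, hwS, hw⟩ : ∃ w ∈ S, ¬ Reach S r' ∅ v w := by
      by_contra hcon
      push Not at hcon
      exact hn ((hcon u0 hu0).symm.trans (hcon v0 hv0))
    obtain ⟨a, b, _, ⟨haS, hbS, _, hab⟩, ha, hb⟩ := exists_exit (p := fun y => Reach S r' ∅ v y)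
      (hconn v hv w hwS) Relation.ReflTransGen.refl hw
    rw [le_min_iff] at hab
    refine ⟨a, haS, ha, ?_⟩
    have : R < dist a b := by
      by_contra hh
      rw [not_lt] at hh
      exact hb (ha.trans (Adj.reach ⟨haS, hbS, Or.inl (le_min hab.1 hh), Or.inl (le_min hab.2 hh)⟩))
    exact min_eq_right (by linarith [hab.1])
  obtain ⟨rb, hrb⟩ := exists_rbar r' Z
  refine ⟨rb, ?_, ?_, ?_⟩
  · intro s hs
    constructor
    · have : r' s ≤ rb s := (hrb s _).2 (Or.inl le_rfl)
      exact lt_of_lt_of_le (lt_min (hpos s hs) hR) this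
    · rcases (hrb s _).1 le_rfl with h | ⟨t, h1, h2⟩
      · exact h.trans (min_le_right _ _)
      · exact h2.trans (hZ3 _ h1)
  · intro u hu v hv
    have := hZ1 u hu v hv
    clear hv
    unfold symReach
    induction this with
    | refl => exact Relation.ReflTransGen.refl
    | @tail a b _ hab ih =>
      by_cases hne : a = b
      · rw [← hne]; exact ih
      · obtain ⟨h1, h2, h3, h4⟩ := hab
        exact Relation.ReflTransGen.tail ih ⟨h1, h2, hne, le_min ((hrb _ _).2 h3) ((hrb _ _).2 h4)⟩
  · intro p
    have hsub : (S.filter fun s => dist s p ≤ rb s) ⊆ (S.filter fun s => dist s p ≤ r s) ∪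
        (Z.filter fun z => r' z.1 < z.2 ∧ dist z.1 p ≤ z.2).image Prod.fst := by
      intro s hs
      obtain ⟨hsS, h⟩ := Finset.mem_filter.1 hs
      by_cases h0 : dist s p ≤ r' s
      · exact Finset.mem_union_left _ (Finset.mem_filter.2 ⟨hsS, h0.trans (min_le_left _ _)⟩)
      rcases (hrb s _).1 h with h | ⟨t, h1, h2⟩
      · exact absurd h h0
      · refine Finset.mem_union_right _ (Finset.mem_image.2 ⟨(s, t), Finset.mem_filter.2 ⟨h1, ?_, h2⟩, rfl⟩)
        simp only
        linarith
    have e1 := (Finset.card_le_card hsub).trans (Finset.card_union_le _ _)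
    have e2 := hi p
    have e3 : ((Z.filter fun z => r' z.1 < z.2 ∧ dist z.1 p ≤ z.2).image Prod.fst).card ≤ c4 d * c3 d := by
      refine Finset.card_image_le.trans (le_trans (le_of_eq ?_) (hZ2 p))
      unfold cov
      congr
    have e4 : c4 d * c3 d ≤ c4 d * c3 d * i := Nat.le_mul_of_pos_right _ hi1
    rw [add_mul, one_mul]
    omega

end BRI

/-- Main theorem: there is a constant `C d` depending only on the dimension such that
the following holds. Let `S ⊂ ℝ^d` be finite with minimum-spanning-tree longest edge
`R_min`, and suppose `r : S → ℝ_{>0}` gives a connected symmetric communication graph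
with interference at most `i`. Then there exists `r̄ : S → ℝ_{>0}` with
`r̄ s ≤ R_min` for all `s`, whose symmetric communication graph is connected, and
whose interference is at most `C d * i`. -/
theorem bounded_radius_low_interference :
    ∃ C : ℕ → ℝ, ∀ (d : ℕ) (S : Finset (EuclideanSpace ℝ (Fin d))), 2 ≤ S.card →
      -- `T` is a Euclidean minimum spanning tree of `S` with longest edge `Rmin`
      ∀ (T : SimpleGraph {x // x ∈ S}), T.Connected → T.IsAcyclic →
      (∀ T' : SimpleGraph {x // x ∈ S}, T'.Connected → T'.IsAcyclic →
        graphWeight d S T ≤ graphWeight d S T') →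
      ∀ Rmin : ℝ,
      (∀ e ∈ T.edgeSet, edgeLen d (e.map Subtype.val) ≤ Rmin) →
      (∃ e ∈ T.edgeSet, edgeLen d (e.map Subtype.val) = Rmin) →
      -- `r` is positive, connected, of interference at most `i`
      ∀ (r : EuclideanSpace ℝ (Fin d) → ℝ) (i : ℕ),
      (∀ s ∈ S, 0 < r s) →
      (∀ u ∈ S, ∀ v ∈ S, symReach S r u v) →
      (∀ p : EuclideanSpace ℝ (Fin d),
        (S.filter fun s => dist s p ≤ r s).card ≤ i) →
      ∃ rbar : EuclideanSpace ℝ (Fin d) → ℝ,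
        (∀ s ∈ S, 0 < rbar s ∧ rbar s ≤ Rmin) ∧
        (∀ u ∈ S, ∀ v ∈ S, symReach S rbar u v) ∧
        ∀ p : EuclideanSpace ℝ (Fin d),
          ((S.filter fun s => dist s p ≤ rbar s).card : ℝ) ≤ C d * i := by
  refine ⟨fun d => ((1 + BRI.c4 d * BRI.c3 d : ℕ) : ℝ), ?_⟩
  intro d S hcard T hT _ _ Rmin hle hex r i hpos hconn hi
  have hdist : ∀ a b : {x // x ∈ S}, T.Adj a b → dist a.1 b.1 ≤ Rmin := by
    intro a b hab
    have := hle s(a, b) hab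
    simpa [edgeLen] using this
  have hR : 0 < Rmin := by
    obtain ⟨e, he, heq⟩ := hex
    induction e using Sym2.ind with
    | _ a b =>
      have hab : T.Adj a b := he
      have hne : a.1 ≠ b.1 := fun h => hab.ne (Subtype.ext h)
      have : dist a.1 b.1 = Rmin := by simpa [edgeLen] using heq
      rw [← this]
      exact dist_pos.2 hne
  have hU : ∀ u ∈ S, ∀ v ∈ S,
      Relation.ReflTransGen (fun a b => a ∈ S ∧ b ∈ S ∧ dist a b ≤ Rmin) u v := by
    intro u hu v hv
    obtain ⟨w⟩ := hT.preconnected ⟨u, hu⟩ ⟨v, hv⟩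
    have key : ∀ a b : {x // x ∈ S}, T.Walk a b →
        Relation.ReflTransGen (fun a b => a ∈ S ∧ b ∈ S ∧ dist a b ≤ Rmin) a.1 b.1 := by
      intro a b w
      induction w with
      | nil => exact Relation.ReflTransGen.refl
      | cons h _ ih => exact Relation.ReflTransGen.head ⟨Subtype.prop _, Subtype.prop _, hdist _ _ h⟩ ih
    exact key _ _ w
  obtain ⟨rb, h1, h2, h3⟩ := BRI.main S Rmin hR (Finset.card_pos.1 (by omega)) hU r i hpos hconn
    (fun p => by convert hi p)
  refine ⟨rb, h1, h2, fun p => ?_⟩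
  have := h3 p
  rw [← Nat.cast_mul, Nat.cast_le]
  convert this
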